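/- Let b ∈ ℝ³ with ‖b‖ = 1, let β > 0, and let k ≥ 2 be an integer. Define the linear map M : (ℝ³)⁴ → (ℝ³)⁴ by M(ρ⁺, ρ⁻, V⁺, V⁻) = ( V⁺ − k·β·ρ⁻ , V⁻ + k·β·ρ⁺ , β·(V⁺ × b) − k·β·V⁻ , β·(V⁻ × b) + k·β·V⁺ ). Then M is a linear bijection. -/

import Mathlib

open Real

noncomputable section

abbrev E3 : Type := EuclideanSpace ℝ (Fin 3)

/-- The cross product on `ℝ³`. -/
def cross (u v : E3) : E3 :=
  (WithLp.equiv 2 (Fin 3 → ℝ)).symm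
    ![u 1 * v 2 - u 2 * v 1, u 2 * v 0 - u 0 * v 2, u 0 * v 1 - u 1 * v 0]

/-- The dot product on `ℝ³`. -/
def dot (u v : E3) : ℝ := u 0 * v 0 + u 1 * v 1 + u 2 * v 2

/-- The curl of a vector field on `ℝ³`, defined componentwise from the Fréchet derivative. -/
def curl (A : E3 → E3) (x : E3) : E3 :=
  (WithLp.equiv 2 (Fin 3 → ℝ)).symm
    ![fderiv ℝ A x (EuclideanSpace.single 1 1) 2 - fderiv ℝ A x (EuclideanSpace.single 2 1) 1,
      fderiv ℝ A x (EuclideanSpace.single 2 1) 0 - fderiv ℝ A x (EuclideanSpace.single 0 1) 2,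
      fderiv ℝ A x (EuclideanSpace.single 0 1) 1 - fderiv ℝ A x (EuclideanSpace.single 1 1) 0]

@[simp] lemma cross_apply_zero (u v : E3) : cross u v 0 = u 1 * v 2 - u 2 * v 1 := rfl

@[simp] lemma cross_apply_one (u v : E3) : cross u v 1 = u 2 * v 0 - u 0 * v 2 := rfl

@[simp] lemma cross_apply_two (u v : E3) : cross u v 2 = u 0 * v 1 - u 1 * v 0 := rfl

lemma cross_add_left (u v w : E3) : cross (u + v) w = cross u w + cross v w := by
  ext i
  fin_cases i <;> simp <;> ring

lemma cross_smul_left (c : ℝ) (u v : E3) : cross (c • u) v = c • cross u v := by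
  ext i
  fin_cases i <;> simp <;> ring

lemma norm_sq_eq_sum_sq (u : E3) : ‖u‖ ^ 2 = u 0 ^ 2 + u 1 ^ 2 + u 2 ^ 2 := by
  simp [EuclideanSpace.norm_sq_eq, Fin.sum_univ_three]

/-- Lagrange's identity. -/
lemma norm_cross_sq_add_dot_sq (u v : E3) :
    ‖cross u v‖ ^ 2 + dot u v ^ 2 = ‖u‖ ^ 2 * ‖v‖ ^ 2 := by
  simp only [norm_sq_eq_sum_sq, dot, cross_apply_zero, cross_apply_one, cross_apply_two]
  ring

lemma norm_cross_le (u v : E3) : ‖cross u v‖ ≤ ‖u‖ * ‖v‖ := by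
  refine le_of_sq_le_sq ?_ (by positivity)
  rw [mul_pow, ← norm_cross_sq_add_dot_sq]
  exact le_add_of_nonneg_right (sq_nonneg _)

/-- If `u ↦ u × b` with `‖b‖ = 1` acts on the pair `(u, v)` as a rotation generator of rate `c > 1`,
then the pair vanishes. -/
lemma eq_zero_of_cross_eq_smul {b u v : E3} (hb : ‖b‖ = 1) {c : ℝ} (hc : 1 < c)
    (hu : cross u b = c • v) (hv : cross v b = -(c • u)) : u = 0 ∧ v = 0 := by
  have h₁ := norm_cross_le u b
  have h₂ := norm_cross_le v b
  rw [hu, hb, norm_smul, Real.norm_of_nonneg (by linarith), mul_one] at h₁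
  rw [hv, hb, norm_neg, norm_smul, Real.norm_of_nonneg (by linarith), mul_one] at h₂
  have hu₀ := norm_nonneg u
  have hv₀ := norm_nonneg v
  constructor <;> refine norm_le_zero_iff.mp ?_ <;> nlinarith

/-- The `k`-th Fourier-harmonic block (`k ≥ 2`) of the frozen-time
linearized fast dynamics acting jointly on the fluctuating position and velocity harmonics,
`M(ρ⁺, ρ⁻, V⁺, V⁻) = (V⁺ − kβ·ρ⁻, V⁻ + kβ·ρ⁺, β·(V⁺×b) − kβ·V⁻, β·(V⁻×b) + kβ·V⁺)`,
is a linear bijection. -/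
theorem position_velocity_harmonic_block_bijective
    (b : E3) (hb : ‖b‖ = 1) (β : ℝ) (hβ : 0 < β) (k : ℕ) (hk : 2 ≤ k)
    (M : E3 × E3 × E3 × E3 → E3 × E3 × E3 × E3)
    (hM : ∀ ρp ρm Vp Vm : E3, M (ρp, ρm, Vp, Vm)
      = (Vp - ((k : ℝ) * β) • ρm, Vm + ((k : ℝ) * β) • ρp,
         β • cross Vp b - ((k : ℝ) * β) • Vm, β • cross Vm b + ((k : ℝ) * β) • Vp)) :
    IsLinearMap ℝ M ∧ Function.Bijective M := by
  have hlin : IsLinearMap ℝ M := by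
    constructor
    · rintro ⟨ρp, ρm, Vp, Vm⟩ ⟨σp, σm, Wp, Wm⟩
      simp only [Prod.mk_add_mk, hM, cross_add_left, Prod.mk.injEq]
      refine ⟨?_, ?_, ?_, ?_⟩ <;> module
    · rintro c ⟨ρp, ρm, Vp, Vm⟩
      simp only [Prod.smul_mk, hM, cross_smul_left, Prod.mk.injEq]
      refine ⟨?_, ?_, ?_, ?_⟩ <;> module
  have hk' : (1 : ℝ) < k := by exact_mod_cast hk
  have hkβ : (k : ℝ) * β ≠ 0 := by positivity
  have hinj : Function.Injective (hlin.mk' M) := by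
    refine (injective_iff_map_eq_zero _).mpr ?_
    rintro ⟨ρp, ρm, Vp, Vm⟩ h
    rw [IsLinearMap.mk'_apply, hM] at h
    simp only [Prod.mk_eq_zero] at h ⊢
    obtain ⟨h₁, h₂, h₃, h₄⟩ := h
    have hp : cross Vp b = (k : ℝ) • Vm := by
      refine smul_right_injective E3 hβ.ne' ?_
      simpa only [smul_smul, mul_comm] using sub_eq_zero.mp h₃
    have hm : cross Vm b = -((k : ℝ) • Vp) := by
      refine smul_right_injective E3 hβ.ne' ?_
      simpa only [smul_neg, smul_smul, mul_comm] using eq_neg_of_add_eq_zero_left h₄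
    obtain ⟨rfl, rfl⟩ := eq_zero_of_cross_eq_smul hb hk' hp hm
    rw [zero_sub, neg_eq_zero, smul_eq_zero_iff_right hkβ] at h₁
    rw [zero_add, smul_eq_zero_iff_right hkβ] at h₂
    exact ⟨h₂, h₁, rfl, rfl⟩
  exact ⟨hlin, hinj, LinearMap.surjective_of_injective hinj⟩

end
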